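/- arXiv:1409.4632 — 3 statements merged into one kernel-verified Lean document; each statement's English description precedes it below -/
import Mathlib

section
/- Every minor of a graph in 𝒢̃ is isomorphic to a subgraph of some graph in 𝒢̃. -/
namespace K24Paper

open SimpleGraph

/-- `H` is a minor of `G`: branch sets indexed by vertices of `H`, pairwise disjoint,
each inducing a connected subgraph of `G`, with every edge of `H` realized by an edge
of `G` between the corresponding branch sets. -/
def IsMinor {W V : Type*} (H : SimpleGraph W) (G : SimpleGraph V) : Prop :=
  ∃ B : W → Set V,
    (∀ w, (G.induce (B w)).Connected) ∧
    (∀ w₁ w₂, w₁ ≠ w₂ → Disjoint (B w₁) (B w₂)) ∧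
    (∀ w₁ w₂, H.Adj w₁ w₂ → ∃ v₁ ∈ B w₁, ∃ v₂ ∈ B w₂, G.Adj v₁ v₂)

/-- `G` is `H`-minor-free. -/
def MinorFree {W V : Type*} (H : SimpleGraph W) (G : SimpleGraph V) : Prop :=
  ¬ IsMinor H G

/-- The complete bipartite graph `K_{2,4}`. -/
def K24 : SimpleGraph (Fin 2 ⊕ Fin 4) := completeBipartiteGraph (Fin 2) (Fin 4)

/-- `G` is `k`-connected: more than `k` vertices, and removing fewer than `k`
vertices leaves a connected graph. -/
def KConnected {V : Type*} (k : ℕ) (G : SimpleGraph V) : Prop :=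
  k < Nat.card V ∧ ∀ S : Set V, S.ncard < k → (G.induce Sᶜ).Connected

/-- The graph `G_{n,r,s}` (with the plus edge if `plus = true`), on vertices
`0, …, n-1` corresponding to `v_1, …, v_n`:  the spine `v_1 v_2 ⋯ v_n`, the edges
`v_1 v_{n-i}` for `1 ≤ i ≤ r`, the edges `v_n v_{1+j}` for `1 ≤ j ≤ s`, and
(if `plus`) the plus edge `v_1 v_n`. -/
def Gnrs (n r s : ℕ) (plus : Bool) : SimpleGraph (Fin n) :=
  SimpleGraph.fromRel (fun a b =>
    b.val = a.val + 1 ∨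
    (a.val = 0 ∧ n - 1 - r ≤ b.val ∧ b.val ≤ n - 2) ∨
    (b.val = n - 1 ∧ 1 ≤ a.val ∧ a.val ≤ s) ∨
    (plus = true ∧ a.val = 0 ∧ b.val = n - 1))

/-- The parameter conditions describing membership in the class `𝒢`. -/
def Gparams (n r s : ℕ) (plus : Bool) : Prop :=
  (plus = true ∧ 4 ≤ n ∧ ((r = 1 ∧ s = n - 3) ∨ (r = n - 3 ∧ s = 1))) ∨
  (5 ≤ n ∧ 2 ≤ r ∧ r ≤ n - 3 ∧ 2 ≤ s ∧ s ≤ n - 3 ∧ (r + s = n - 2 ∨ r + s = n - 1))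

/-- `G` belongs to `𝒢̃`, i.e. `G` is isomorphic to a graph of the class `𝒢`. -/
def InGtilde {V : Type*} (G : SimpleGraph V) : Prop :=
  ∃ n r s plus, Gparams n r s plus ∧ Nonempty (G ≃g Gnrs n r s plus)

/-- The graph obtained from `G` by subdividing every edge in `F` once:
new vertices are the members of `F`. -/
def SubdivideEdges {V : Type*} (G : SimpleGraph V) (F : Set (Sym2 V)) :
    SimpleGraph (V ⊕ F) :=
  SimpleGraph.fromRel (fun a b =>
    match a, b with
    | Sum.inl u, Sum.inl v => G.Adj u v ∧ s(u, v) ∉ F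
    | Sum.inl u, Sum.inr e => u ∈ (e : Sym2 V)
    | Sum.inr e, Sum.inl u => u ∈ (e : Sym2 V)
    | Sum.inr _, Sum.inr _ => False)

/-- A set `F` of edges of a graph `G` is subdividable if subdividing every edge
of `F` once yields a `K_{2,4}`-minor-free graph. -/
def Subdividable {V : Type*} (G : SimpleGraph V) (F : Set (Sym2 V)) : Prop :=
  F ⊆ G.edgeSet ∧ MinorFree K24 (SubdivideEdges G F)

/-- `F` is a maximal subdividable set of edges of `G`. -/
def MaxSubdividable {V : Type*} (G : SimpleGraph V) (F : Set (Sym2 V)) : Prop :=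
  Subdividable G F ∧ ∀ F', Subdividable G F' → F ⊆ F' → F' = F

/-- `l` lists vertices along a path of `G` (consecutive entries adjacent, no repeats)
such that no two edges of `G` cross with respect to this ordering. -/
def OuterListing {U : Type*} (G : SimpleGraph U) (l : List U) : Prop :=
  l.Nodup ∧ l.Chain' G.Adj ∧
  ∀ (i k j m : ℕ) (h1 : i < k) (h2 : k < j) (h3 : j < m) (hm : m < l.length),
    ¬(G.Adj (l.get ⟨i, by omega⟩) (l.get ⟨j, by omega⟩) ∧
      G.Adj (l.get ⟨k, by omega⟩) (l.get ⟨m, by omega⟩))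

/-- The graph `G` restricted to the vertex set `A` is `xy`-outerplanar: it has a
hamilton `xy`-path (listing exactly the vertices of `A`) such that no two edges
cross with respect to it. -/
def XYOuterplanar {U : Type*} (G : SimpleGraph U) (A : Set U) (x y : U) : Prop :=
  ∃ l : List U, (∀ v, v ∈ l ↔ v ∈ A) ∧ l.head? = some x ∧ l.getLast? = some y ∧
    OuterListing G l

/-- A block: a connected graph with no cutvertex. -/
def IsBlock {V : Type*} (G : SimpleGraph V) : Prop :=
  G.Connected ∧ ∀ v : V, (G.induce {u | u ≠ v}).Preconnected

/-- `G + xy`: the graph `G` with the edge `xy` added (if not already present). -/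
def AddEdge {U : Type*} (G : SimpleGraph U) (x y : U) : SimpleGraph U :=
  G ⊔ SimpleGraph.fromRel (fun a b => a = x ∧ b = y)

/-- A standard `K_{2,t}` minor `(R₁, R₂; S)` of `G`. -/
def StdK2tMinor {V : Type*} (G : SimpleGraph V) (t : ℕ) (R₁ R₂ S : Set V) : Prop :=
  Disjoint R₁ R₂ ∧ Disjoint (R₁ ∪ R₂) S ∧
  (G.induce R₁).Connected ∧ (G.induce R₂).Connected ∧
  S.Finite ∧ S.ncard = t ∧
  ∀ v ∈ S, (∃ w ∈ R₁, G.Adj v w) ∧ (∃ w ∈ R₂, G.Adj v w)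

/-- `K_{3,3}` with parts `{0,1,2}` and `{3,4,5}`. -/
def K33 : SimpleGraph (Fin 6) :=
  SimpleGraph.fromRel (fun a b => a.val < 3 ∧ 3 ≤ b.val)

/-- The graph `A = K_{3,3} + v₂v₃`. -/
def GA : SimpleGraph (Fin 6) := AddEdge K33 1 2

/-- The graph `A⁺ = K_{3,3} + v₂v₃ + v₅v₆`. -/
def GAplus : SimpleGraph (Fin 6) := AddEdge GA 4 5

/-- The graph `B`, on vertices `h, r₁, r₂, r₃, r₄, g₁, g₂ = 0, …, 6`. -/
def GB : SimpleGraph (Fin 7) :=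
  SimpleGraph.fromRel (fun a b => (a.val, b.val) ∈
    [(0,3),(0,4),(1,4),(2,3),(3,4),(5,0),(5,1),(5,2),(6,0),(6,1),(6,2)])

/-- The graph `B⁺ = B + g₁g₂`. -/
def GBplus : SimpleGraph (Fin 7) := AddEdge GB 5 6

/-- The graph `C⁺`, on vertices `v₁, …, v₈ = 0, …, 7`. -/
def GCplus : SimpleGraph (Fin 8) :=
  SimpleGraph.fromRel (fun a b => (a.val, b.val) ∈
    [(0,1),(0,2),(1,2),(3,4),(3,5),(3,6),(3,7),(4,5),(4,6),(4,7),(2,5),(1,7),(0,6)])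

/-- The graph `C = C⁺ ∖ v₄v₅`. -/
def GC : SimpleGraph (Fin 8) := GCplus.deleteEdges {s(3, 4)}

/-- The graph `D`, on vertices `t₁, t₂, t₃, d₁, d₂, d₃, g = 0, …, 6`. -/
def GD : SimpleGraph (Fin 7) :=
  SimpleGraph.fromRel (fun a b => (a.val, b.val) ∈
    [(0,1),(0,2),(1,2),(3,4),(3,5),(4,5),(0,3),(1,4),(2,5),(6,0),(6,1),(6,2)])

/-- The complete graph `K₅`. -/
def GK5 : SimpleGraph (Fin 5) := completeGraph (Fin 5)

end K24Paper

namespace K24Paper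

/-- The maximal graphs of the class, with a single parameter `s`. -/
def Mx (n s : ℕ) : SimpleGraph (Fin n) := Gnrs n (n - 1 - s) s true

lemma Gnrs_adj_iff {n r s : ℕ} {plus : Bool} (x y : Fin n) :
    (Gnrs n r s plus).Adj x y ↔ x.val ≠ y.val ∧
    ((y.val = x.val + 1 ∨
    (x.val = 0 ∧ n - 1 - r ≤ y.val ∧ y.val ≤ n - 2) ∨
    (y.val = n - 1 ∧ 1 ≤ x.val ∧ x.val ≤ s) ∨
    (plus = true ∧ x.val = 0 ∧ y.val = n - 1)) ∨
    (x.val = y.val + 1 ∨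
    (y.val = 0 ∧ n - 1 - r ≤ x.val ∧ x.val ≤ n - 2) ∨
    (x.val = n - 1 ∧ 1 ≤ y.val ∧ y.val ≤ s) ∨
    (plus = true ∧ y.val = 0 ∧ x.val = n - 1))) := by
  unfold Gnrs
  rw [SimpleGraph.fromRel_adj, Ne, Fin.ext_iff]

/-- Numerical form of adjacency in `Mx`. -/
def MR (n s x y : ℕ) : Prop :=
  x ≠ y ∧
    ((y = x + 1 ∨ (x = 0 ∧ s ≤ y ∧ y ≤ n - 2) ∨ (y = n - 1 ∧ 1 ≤ x ∧ x ≤ s) ∨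
      (x = 0 ∧ y = n - 1)) ∨
    (x = y + 1 ∨ (y = 0 ∧ s ≤ x ∧ x ≤ n - 2) ∨ (x = n - 1 ∧ 1 ≤ y ∧ y ≤ s) ∨
      (y = 0 ∧ x = n - 1)))

lemma Mx_adj_iff {n s : ℕ} (hs : s ≤ n - 1) (x y : Fin n) :
    (Mx n s).Adj x y ↔ MR n s x.val y.val := by
  unfold Mx MR
  rw [Gnrs_adj_iff]
  have : n - 1 - (n - 1 - s) = s := by omega
  simp only [this, true_and]

/-- Every `Mx n s` is contained in a graph of the class on the same vertices. -/
lemma Mx_params {n s : ℕ} (hn : 4 ≤ n) (h1 : 1 ≤ s) (h2 : s ≤ n - 2) :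
    ∃ r s', Gparams n r s' true ∧
      ∀ x y, (Mx n s).Adj x y → (Gnrs n r s' true).Adj x y := by
  by_cases hs1 : s = 1
  · refine ⟨n - 3, 1, Or.inl ⟨rfl, hn, Or.inr ⟨rfl, rfl⟩⟩, fun x y h => ?_⟩
    rw [Mx_adj_iff (by omega)] at h
    rw [Gnrs_adj_iff]
    unfold MR at h
    simp only [true_and]
    omega
  by_cases hs2 : s = n - 2
  · refine ⟨1, n - 3, Or.inl ⟨rfl, hn, Or.inl ⟨rfl, rfl⟩⟩, fun x y h => ?_⟩
    rw [Mx_adj_iff (by omega)] at h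
    rw [Gnrs_adj_iff]
    unfold MR at h
    simp only [true_and]
    omega
  · exact ⟨n - 1 - s, s, Or.inr ⟨by omega, by omega, by omega, by omega, by omega, by omega⟩,
      fun x y h => h⟩

/-- Every graph of the class is contained in some `Mx n s` on the same vertices. -/
lemma params_Mx {n r s : ℕ} {plus : Bool} (h : Gparams n r s plus) :
    4 ≤ n ∧ ∃ s', 1 ≤ s' ∧ s' ≤ n - 2 ∧
      ∀ x y, (Gnrs n r s plus).Adj x y → (Mx n s').Adj x y := by
  have key : 4 ≤ n ∧ ∃ s', 1 ≤ s' ∧ s' ≤ n - 2 ∧ s ≤ s' ∧ s' ≤ n - 1 - r := by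
    rcases h with ⟨_, h4, h | h⟩ | h
    · exact ⟨h4, s, by omega, by omega, by omega, by omega⟩
    · exact ⟨h4, s, by omega, by omega, by omega, by omega⟩
    · exact ⟨by omega, s, by omega, by omega, by omega, by omega⟩
  obtain ⟨h4, s', a1, a2, a3, a4⟩ := key
  refine ⟨h4, s', a1, a2, fun x y hxy => ?_⟩
  rw [Gnrs_adj_iff] at hxy
  rw [Mx_adj_iff (by omega)]
  unfold MR
  omega

/-- Branch sets can be pushed forward along a map that collapses or preserves edges and
never identifies vertices of distinct branch sets. -/
lemma minor_push {V V' W : Type*} {H : SimpleGraph W} {G : SimpleGraph V}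
    {G' : SimpleGraph V'} (φ : V → V') (B : W → Set V)
    (hc : ∀ w, (G.induce (B w)).Connected)
    (he : ∀ w₁ w₂, H.Adj w₁ w₂ → ∃ v₁ ∈ B w₁, ∃ v₂ ∈ B w₂, G.Adj v₁ v₂)
    (hφ : ∀ x y, G.Adj x y → φ x = φ y ∨ G'.Adj (φ x) (φ y))
    (hd : ∀ w₁ w₂, w₁ ≠ w₂ → ∀ x ∈ B w₁, ∀ y ∈ B w₂, φ x ≠ φ y) :
    IsMinor H G' := by
  refine ⟨fun w => φ '' B w, fun w => ?_, fun w₁ w₂ h => ?_, fun w₁ w₂ h => ?_⟩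
  · have hne := (hc w).nonempty
    rw [SimpleGraph.connected_iff]
    refine ⟨?_, ?_⟩
    · have key : ∀ x y : B w, (G.induce (B w)).Reachable x y →
          (G'.induce (φ '' B w)).Reachable ⟨φ x, Set.mem_image_of_mem φ x.2⟩
            ⟨φ y, Set.mem_image_of_mem φ y.2⟩ := by
        rintro x y ⟨p⟩
        induction p with
        | nil => exact SimpleGraph.Reachable.refl _
        | @cons a b c hab _ ih =>
          refine SimpleGraph.Reachable.trans ?_ ih
          rcases hφ a b hab with h | h
          · have : (⟨φ a, Set.mem_image_of_mem φ a.2⟩ : φ '' B w) =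
              ⟨φ b, Set.mem_image_of_mem φ b.2⟩ := Subtype.ext h
            rw [this]
          · exact SimpleGraph.Adj.reachable (by simpa using h)
      rintro ⟨_, x, hx, rfl⟩ ⟨_, y, hy, rfl⟩
      exact key ⟨x, hx⟩ ⟨y, hy⟩ ((hc w).preconnected _ _)
    · obtain ⟨x⟩ := hne
      exact ⟨⟨φ x, Set.mem_image_of_mem φ x.2⟩⟩
  · rw [Set.disjoint_left]
    rintro _ ⟨x, hx, rfl⟩ ⟨y, hy, hxy⟩
    exact hd w₁ w₂ h x hx y hy hxy.symm
  · obtain ⟨x, hx, y, hy, hxy⟩ := he w₁ w₂ h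
    refine ⟨φ x, Set.mem_image_of_mem φ hx, φ y, Set.mem_image_of_mem φ hy, ?_⟩
    exact (hφ x y hxy).resolve_left (hd w₁ w₂ h.ne x hx y hy)

/-- Simplified adjacency condition for `x < y`. -/
def ML (n s x y : ℕ) : Prop := y = x + 1 ∨ (x = 0 ∧ s ≤ y) ∨ (y = n - 1 ∧ x ≤ s)

/-- The essential properties of a numerical contraction map. -/
def Contr' (n s u v s' : ℕ) (f : ℕ → ℕ) : Prop :=
  1 ≤ s' ∧ s' ≤ n - 3 ∧ (∀ x, x < n → f x < n - 1) ∧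
  (∀ x y, x < y → y < n → ML n s x y →
    f x = f y ∨ ML (n - 1) s' (f x) (f y) ∨ ML (n - 1) s' (f y) (f x)) ∧
  (∀ x y, x < y → y < n → f x = f y → x = u ∧ y = v)

/-- The properties required of a numerical contraction map. -/
def Contr (n s u v s' : ℕ) (f : ℕ → ℕ) : Prop :=
  1 ≤ s' ∧ s' ≤ n - 3 ∧ (∀ x, x < n → f x < n - 1) ∧
  (∀ x y, x < n → y < n → MR n s x y → f x = f y ∨ MR (n - 1) s' (f x) (f y)) ∧
  (∀ x y, x < n → y < n → f x = f y → x = y ∨ (x = u ∧ y = v) ∨ (x = v ∧ y = u))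

lemma MR_of_ML {n s x y : ℕ} (hx : x < n) (hy : y < n) (hxy : x ≠ y)
    (h : ML n s x y) : MR n s x y := by
  unfold ML at h
  unfold MR
  omega

lemma ML_of_MR {n s x y : ℕ} (hxy : x < y) (hs : s ≤ n - 1) (h : MR n s x y) :
    ML n s x y := by
  unfold MR at h
  unfold ML
  omega

lemma MR_symm {n s x y : ℕ} (h : MR n s x y) : MR n s y x := ⟨h.1.symm, h.2.symm⟩

lemma Contr_of_Contr' {n s u v s' : ℕ} {f : ℕ → ℕ} (hs : s ≤ n - 1)
    (h : Contr' n s u v s' f) : Contr n s u v s' f := by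
  obtain ⟨a1, a2, a3, a4, a5⟩ := h
  have key : ∀ x y, x < y → y < n → MR n s x y →
      f x = f y ∨ MR (n - 1) s' (f x) (f y) := by
    intro x y hxy hy h
    by_cases he : f x = f y
    · exact Or.inl he
    · have hfx := a3 x (by omega)
      have hfy := a3 y hy
      rcases a4 x y hxy hy (ML_of_MR hxy hs h) with h | h | h
      · exact Or.inl h
      · exact Or.inr (MR_of_ML hfx hfy he h)
      · exact Or.inr (MR_symm (MR_of_ML hfy hfx (Ne.symm he) h))
  refine ⟨a1, a2, a3, fun x y hx hy h => ?_, fun x y hx hy h => ?_⟩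
  · rcases lt_trichotomy x y with hxy | hxy | hxy
    · exact key x y hxy hy h
    · exact absurd hxy h.1
    · rcases key y x hxy hx (MR_symm h) with h | h
      · exact Or.inl h.symm
      · exact Or.inr (MR_symm h)
  · rcases lt_trichotomy x y with hxy | hxy | hxy
    · exact Or.inr (Or.inl (a5 x y hxy hy h))
    · exact Or.inl hxy
    · exact Or.inr (Or.inr (a5 y x hxy hx h.symm).symm)

lemma contr_spine {n s i : ℕ} (hn : 5 ≤ n) (h1 : 1 ≤ s) (h2 : s ≤ n - 2)
    (hi : 1 ≤ i) (hi' : i + 1 ≤ n - 2) : ∃ s' f, Contr n s i (i + 1) s' f := by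
  refine ⟨if s ≤ i then s else s - 1, fun x => if x ≤ i then x else x - 1, ?_⟩
  refine Contr_of_Contr' (by omega) ?_
  unfold Contr' ML
  refine ⟨by split_ifs <;> omega, by split_ifs <;> omega, fun x hx => ?_,
    fun x y hx hy h => ?_, fun x y hx hy h => ?_⟩
  · dsimp only
    split_ifs <;> omega
  · dsimp only
    rcases h with h | h | h <;> split_ifs <;> omega
  · dsimp only at h
    split_ifs at h <;> omega

lemma contr_left {n s i : ℕ} (hn : 5 ≤ n) (h1 : 1 ≤ s) (h2 : s ≤ n - 2)
    (hi : 1 ≤ i) (hi' : i ≤ n - 2) (hi2 : i = 1 ∨ s ≤ i) : ∃ s' f, Contr n s 0 i s' f := by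
  refine ⟨if s < i then s else if s = 1 then 1 else s - 1,
    fun x => if x < i then x else if x = i then 0 else x - 1, ?_⟩
  refine Contr_of_Contr' (by omega) ?_
  unfold Contr' ML
  refine ⟨by split_ifs <;> omega, by split_ifs <;> omega, fun x hx => ?_,
    fun x y hx hy h => ?_, fun x y hx hy h => ?_⟩
  · dsimp only
    split_ifs <;> omega
  · dsimp only
    rcases h with h | h | h <;> split_ifs <;> omega
  · dsimp only at h
    split_ifs at h <;> omega

lemma contr_right {n s i : ℕ} (hn : 5 ≤ n) (h1 : 1 ≤ s) (h2 : s ≤ n - 2)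
    (hi : 1 ≤ i) (hi' : i ≤ n - 2) (hi2 : i = n - 2 ∨ i ≤ s) :
    ∃ s' f, Contr n s i (n - 1) s' f := by
  refine ⟨if i < s then s - 1 else if s = n - 2 then n - 3 else s,
    fun x => if x < i then x else if x = i then n - 2 else x - 1, ?_⟩
  refine Contr_of_Contr' (by omega) ?_
  unfold Contr' ML
  refine ⟨by split_ifs <;> omega, by split_ifs <;> omega, fun x hx => ?_,
    fun x y hx hy h => ?_, fun x y hx hy h => ?_⟩
  · dsimp only
    split_ifs <;> omega
  · dsimp only
    rcases h with h | h | h <;> split_ifs <;> omega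
  · dsimp only at h
    split_ifs at h <;> omega

lemma contr_plus {n s : ℕ} (hn : 5 ≤ n) (h1 : 1 ≤ s) (h2 : s ≤ n - 2) :
    ∃ s' f, Contr n s 0 (n - 1) s' f := by
  refine ⟨1, fun x => if x = n - 1 then 0 else x, ?_⟩
  refine Contr_of_Contr' (by omega) ?_
  unfold Contr' ML
  refine ⟨by omega, by omega, fun x hx => ?_,
    fun x y hx hy h => ?_, fun x y hx hy h => ?_⟩
  · dsimp only
    split_ifs <;> omega
  · dsimp only
    rcases h with h | h | h <;> split_ifs <;> omega
  · dsimp only at h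
    split_ifs at h <;> omega

lemma contr_lt {n s u v : ℕ} (hn : 5 ≤ n) (h1 : 1 ≤ s) (h2 : s ≤ n - 2)
    (hv : v < n) (huv : u < v) (h : MR n s u v) : ∃ s' f, Contr n s u v s' f := by
  unfold MR at h
  by_cases hu0 : u = 0
  · subst hu0
    by_cases hvn : v = n - 1
    · subst hvn
      exact contr_plus hn h1 h2
    · exact contr_left hn h1 h2 (by omega) (by omega) (by omega)
  · by_cases hvn : v = n - 1
    · subst hvn
      exact contr_right hn h1 h2 (by omega) (by omega) (by omega)
    · obtain rfl : v = u + 1 := by omega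
      exact contr_spine hn h1 h2 (by omega) (by omega)

/-- Contracting an edge of `Mx n s` gives a subgraph of a smaller such graph. -/
lemma contr_any {n s u v : ℕ} (hn : 5 ≤ n) (h1 : 1 ≤ s) (h2 : s ≤ n - 2)
    (hu : u < n) (hv : v < n) (h : MR n s u v) : ∃ s' f, Contr n s u v s' f := by
  rcases lt_trichotomy u v with huv | huv | huv
  · exact contr_lt hn h1 h2 hv huv h
  · exact absurd huv h.1
  · obtain ⟨s', f, a1, a2, a3, a4, a5⟩ :=
      contr_lt hn h1 h2 hu huv (show MR n s v u from ⟨h.1.symm, h.2.symm⟩)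
    exact ⟨s', f, a1, a2, a3, a4, fun x y hx hy hxy => by
      have := a5 x y hx hy hxy
      tauto⟩

/-- If all branch sets are subsingletons, the minor is a subgraph. -/
lemma minor_singleton {V W : Type*} {H : SimpleGraph W} {G : SimpleGraph V} (B : W → Set V)
    (hc : ∀ w, (G.induce (B w)).Connected)
    (hd : ∀ w₁ w₂, w₁ ≠ w₂ → Disjoint (B w₁) (B w₂)) :
    ∃ f : W ↪ V, ∀ w, f w ∈ B w := by
  have hne : ∀ w, ∃ x, x ∈ B w := fun w => by
    obtain ⟨x⟩ := (hc w).nonempty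
    exact ⟨x, x.2⟩
  choose f hf using hne
  refine ⟨⟨f, fun a b hab => ?_⟩, hf⟩
  by_contra hne
  exact Set.disjoint_left.1 (hd a b hne) (hf a) (hab ▸ hf b)

lemma minor_Mx {W : Type*} (H : SimpleGraph W) (n : ℕ) (hn : 4 ≤ n) :
    ∀ s, 1 ≤ s → s ≤ n - 2 → IsMinor H (Mx n s) →
    ∃ m t, 4 ≤ m ∧ 1 ≤ t ∧ t ≤ m - 2 ∧
      ∃ f : W ↪ Fin m, ∀ a b, H.Adj a b → (Mx m t).Adj (f a) (f b) := by
  induction n, hn using Nat.le_induction with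
  | base =>
    rintro s h1 h2 ⟨B, hc, hd, -⟩
    obtain ⟨f, -⟩ := minor_singleton (H := H) B hc hd
    refine ⟨4, s, le_rfl, h1, h2, f, fun a b hab => ?_⟩
    rw [Mx_adj_iff (by omega)]
    have : f a ≠ f b := fun h => hab.ne (f.injective h)
    have h3 : (f a).val ≠ (f b).val := fun h => this (Fin.ext h)
    have h4 := (f a).isLt
    have h5 := (f b).isLt
    unfold MR
    omega
  | succ n hn ih =>
    rintro s h1 h2 ⟨B, hc, hd, he⟩
    by_cases hB : ∃ w, ∃ u ∈ B w, ∃ v ∈ B w, (Mx (n + 1) s).Adj u v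
    · obtain ⟨w, u, hu, v, hv, huv⟩ := hB
      rw [Mx_adj_iff (by omega)] at huv
      obtain ⟨s', f, a1, a2, a3, a4, a5⟩ :=
        contr_any (by omega) h1 h2 u.isLt v.isLt huv
      refine ih s' a1 (by omega) (minor_push (fun x => ⟨f x.val, a3 x.val x.isLt⟩) B hc he ?_ ?_)
      · intro x y hxy
        rw [Mx_adj_iff (by omega)] at hxy
        rw [Mx_adj_iff (by omega), Fin.ext_iff]
        exact a4 x.val y.val x.isLt y.isLt hxy
      · intro w₁ w₂ hw x hx y hy hxy
        rw [Fin.ext_iff] at hxy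
        have own : ∀ z w' w'', z ∈ B w' → z ∈ B w'' → w' = w'' := by
          intro z w' w'' h' h''
          by_contra hne
          exact Set.disjoint_left.1 (hd w' w'' hne) h' h''
        rcases a5 x.val y.val x.isLt y.isLt hxy with h | ⟨h, h'⟩ | ⟨h, h'⟩
        · obtain rfl := Fin.ext h
          exact hw (own x _ _ hx hy)
        · obtain rfl := Fin.ext h
          obtain rfl := Fin.ext h'
          exact hw ((own _ _ _ hx hu).trans (own _ _ _ hv hy))
        · obtain rfl := Fin.ext h
          obtain rfl := Fin.ext h'
          exact hw ((own _ _ _ hx hv).trans (own _ _ _ hu hy))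
    · obtain ⟨f, hf⟩ := minor_singleton (H := H) B hc hd
      have hsub : ∀ w, ∀ x ∈ B w, x = f w := by
        intro w x hx
        by_contra hne
        obtain ⟨p⟩ := (hc w).preconnected ⟨x, hx⟩ ⟨f w, hf w⟩
        cases p with
        | nil => exact hne rfl
        | @cons _ b _ hab _ => exact hB ⟨w, x, hx, b.val, b.2, by simpa using hab⟩
      refine ⟨n + 1, s, by omega, h1, h2, f, fun a b hab => ?_⟩
      obtain ⟨x, hx, y, hy, hxy⟩ := he a b hab
      rwa [hsub a x hx, hsub b y hy] at hxy

/-- Corollary 6: every minor of a graph in `𝒢̃` is isomorphic to a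
subgraph of some graph in `𝒢̃`. -/
theorem minor_of_Gtilde_isSubgraph {V W : Type*} (G : SimpleGraph V) (H : SimpleGraph W)
    (hG : InGtilde G) (hm : IsMinor H G) :
    ∃ n r s plus, Gparams n r s plus ∧
      ∃ f : W ↪ Fin n, ∀ a b, H.Adj a b → (Gnrs n r s plus).Adj (f a) (f b) := by
  obtain ⟨n, r, s, plus, hp, ⟨e⟩⟩ := hG
  obtain ⟨hn, s', a1, a2, hsub⟩ := params_Mx hp
  obtain ⟨B, hc, hd, he⟩ := hm
  have hm' : IsMinor H (Mx n s') := by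
    refine minor_push (fun x => e x) B hc he (fun x y hxy => Or.inr (hsub _ _ (e.map_adj_iff.2 hxy)))
      (fun w₁ w₂ hw x hx y hy hxy => ?_)
    obtain rfl := e.injective hxy
    exact Set.disjoint_left.1 (hd w₁ w₂ hw) hx hy
  obtain ⟨m, t, hm4, t1, t2, f, hf⟩ := minor_Mx H n hn s' a1 a2 hm'
  obtain ⟨r', t', hp', hsub'⟩ := Mx_params hm4 t1 t2
  exact ⟨m, r', t', true, hp', f, fun a b hab => hsub' _ _ (hf a b hab)⟩

end K24Paper
end

section
/- If a 3-connected simple graph H is a minor of a 3-connected simple graph G, then there is a sequence of 3-connected simple graphs G_0, G_1, …, G_k with G_0 isomorphic to G and G_k isomorphic to H, such that each G_{i+1} is obtained from G_i by deleting a single edge or by contracting a single edge (where after contraction any resulting parallel edges are replaced by a single edge, so all graphs in the sequence are simple). -/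
namespace K24Paper

open SimpleGraph

/-- The simple graph obtained from `G` by contracting the edge `uv` onto `u`
(deleting `v`, and replacing parallel edges by single edges). -/
def ContractEdge {V : Type*} (G : SimpleGraph V) (u v : V) :
    SimpleGraph {w : V // w ≠ v} :=
  SimpleGraph.fromRel (fun a b =>
    G.Adj a.val b.val ∨ (a.val = u ∧ G.Adj v b.val) ∨ (b.val = u ∧ G.Adj v a.val))

/-- `G'` is obtained from `G` by deleting a single edge or contracting a single edge
(up to identification of the vertex sets). -/
def MinorStep {V V' : Type*} (G : SimpleGraph V) (G' : SimpleGraph V') : Prop :=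
  (∃ e ∈ G.edgeSet, Nonempty (G' ≃g G.deleteEdges {e})) ∨
  (∃ u v : V, G.Adj u v ∧ Nonempty (G' ≃g ContractEdge G u v))

theorem pair_lt {V : Type*} (x y : V) : ({x, y} : Set V).ncard < 3 := by
  have h1 := Set.ncard_insert_le x ({y} : Set V)
  rw [Set.ncard_singleton] at h1
  omega

/-- Connectivity of a vertex set, expressed through cuts. -/
def ConnS {V : Type*} (G : SimpleGraph V) (S : Set V) : Prop :=
  S.Nonempty ∧ ∀ p : V → Prop, (∃ a ∈ S, p a) → (∃ b ∈ S, ¬ p b) →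
    ∃ a ∈ S, ∃ b ∈ S, p a ∧ ¬ p b ∧ G.Adj a b

theorem connS_iff {V : Type*} (G : SimpleGraph V) (S : Set V) :
    (G.induce S).Connected ↔ ConnS G S := by
  constructor
  · intro h
    obtain ⟨x⟩ := h.nonempty
    refine ⟨⟨x.1, x.2⟩, ?_⟩
    rintro p ⟨a, ha, hpa⟩ ⟨b, hb, hpb⟩
    obtain ⟨w⟩ := h.preconnected ⟨a, ha⟩ ⟨b, hb⟩
    obtain ⟨d, _, h1, h2⟩ := w.exists_boundary_dart {y | p y.1} hpa hpb
    exact ⟨d.fst.1, d.fst.2, d.snd.1, d.snd.2, h1, h2, d.adj⟩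
  · rintro ⟨⟨x, hx⟩, h⟩
    haveI : Nonempty S := ⟨⟨x, hx⟩⟩
    refine ⟨?_⟩
    rintro ⟨a, ha⟩ ⟨b, hb⟩
    by_contra hc
    obtain ⟨c, hc1, d, hd1, ⟨hcS, hcr⟩, hd, hadj⟩ :=
      h (fun y => ∃ hy : y ∈ S, (G.induce S).Reachable ⟨a, ha⟩ ⟨y, hy⟩)
        ⟨a, ha, ha, SimpleGraph.Reachable.refl _⟩ ⟨b, hb, fun ⟨_, h2⟩ => hc h2⟩
    apply hd
    refine ⟨hd1, hcr.trans (SimpleGraph.Adj.reachable ?_)⟩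
    exact hadj

/-- A spanning model of `H` in `G`. -/
def SM {V W : Type*} (G : SimpleGraph V) (H : SimpleGraph W) (f : V → W) : Prop :=
  (∀ t, ConnS G {a | f a = t}) ∧
    ∀ s t, H.Adj s t → ∃ a b, f a = s ∧ f b = t ∧ G.Adj a b

theorem SM.isMinor {V W : Type*} {G : SimpleGraph V} {H : SimpleGraph W} {f : V → W}
    (h : SM G H f) : IsMinor H G := by
  refine ⟨fun t => {a | f a = t}, fun t => (connS_iff _ _).2 (h.1 t), ?_, ?_⟩
  · intro s t hst
    rw [Set.disjoint_left]
    intro a ha hb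
    exact hst (ha.symm.trans hb)
  · intro s t hst
    obtain ⟨a, b, ha, hb, hab⟩ := h.2 s t hst
    exact ⟨a, ha, b, hb, hab⟩

theorem connS_insert {V : Type*} {G : SimpleGraph V} {S : Set V} (hS : ConnS G S) {a b : V}
    (ha : a ∈ S) (hab : G.Adj a b) : ConnS G (insert b S) := by
  refine ⟨⟨b, Set.mem_insert _ _⟩, ?_⟩
  rintro p ⟨c, hc, hpc⟩ ⟨d, hd, hpd⟩
  by_cases h1 : ∃ c ∈ S, p c
  · by_cases h2 : ∃ d ∈ S, ¬ p d
    · obtain ⟨c, hc, d, hd, h⟩ := hS.2 p h1 h2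
      exact ⟨c, Or.inr hc, d, Or.inr hd, h⟩
    · push Not at h2
      have : d = b := by
        rcases hd with h | h
        · exact h
        · exact absurd (h2 d h) hpd
      subst this
      exact ⟨a, Or.inr ha, d, Or.inl rfl, h2 a ha, hpd, hab⟩
  · push Not at h1
    have : c = b := by
      rcases hc with h | h
      · exact h
      · exact absurd hpc (h1 c h)
    subst this
    exact ⟨c, Or.inl rfl, a, Or.inr ha, hpc, h1 a ha, hab.symm⟩

theorem exists_SM_aux {V W : Type*} [Fintype V] {G : SimpleGraph V} {H : SimpleGraph W}
    (hG : ConnS G Set.univ) (hW : Nonempty W) (n : ℕ) :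
    ∀ g : V → Option W, {a | g a = none}.ncard = n →
      (∀ t, ConnS G {a | g a = some t}) →
      (∀ s t, H.Adj s t → ∃ a b, g a = some s ∧ g b = some t ∧ G.Adj a b) →
      ∃ f, SM G H f := by
  classical
  induction n with
  | zero =>
    intro g hg h1 h2
    rw [Set.ncard_eq_zero (Set.toFinite _)] at hg
    have hs : ∀ a, ∃ t, g a = some t := by
      intro a
      rw [← Option.ne_none_iff_exists']
      intro h
      have : a ∈ {a | g a = none} := h
      rw [hg] at this
      exact this
    choose f hf using hs
    refine ⟨f, ?_, ?_⟩
    · intro t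
      have := h1 t
      simpa [hf] using this
    · intro s t hst
      obtain ⟨a, b, ha, hb, hab⟩ := h2 s t hst
      exact ⟨a, b, by simpa [hf] using ha, by simpa [hf] using hb, hab⟩
  | succ n ih =>
    intro g hg h1 h2
    obtain ⟨t0⟩ := hW
    obtain ⟨x, hx⟩ := (h1 t0).1
    have hne : {a | g a = none}.Nonempty := by
      apply Set.nonempty_of_ncard_ne_zero
      omega
    obtain ⟨y, hy⟩ := hne
    obtain ⟨a, -, b, -, ha, hb, hab⟩ := hG.2 (fun a => g a ≠ none)
      ⟨x, Set.mem_univ _, by simp only [Set.mem_setOf_eq] at hx; simp [hx]⟩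
      ⟨y, Set.mem_univ _, by simpa using hy⟩
    obtain ⟨t, ht⟩ := Option.ne_none_iff_exists'.1 ha
    have hb : g b = none := by simpa using hb
    have hkeep : ∀ c s, g c = some s → Function.update g b (some t) c = some s := by
      intro c s hc
      have : c ≠ b := by rintro rfl; simp [hb] at hc
      rw [Function.update_of_ne this]; exact hc
    refine ih (Function.update g b (some t)) ?_ ?_ ?_
    · have : {a | Function.update g b (some t) a = none} = {a | g a = none} \ {b} := by
        ext c
        by_cases hc : c = b
        · subst hc; simp
        · simp [Function.update_of_ne hc, hc]
      rw [this, Set.ncard_diff_singleton_of_mem (by simpa using hb)]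
      omega
    · intro s
      by_cases hst : s = t
      · subst hst
        have : {a | Function.update g b (some s) a = some s} = insert b {a | g a = some s} := by
          ext c
          by_cases hc : c = b
          · subst hc; simp
          · simp [Function.update_of_ne hc, hc]
        rw [this]
        exact connS_insert (h1 s) ht hab
      · have : {a | Function.update g b (some t) a = some s} = {a | g a = some s} := by
          ext c
          by_cases hc : c = b
          · subst hc; simp [hb, Ne.symm hst]
          · simp [Function.update_of_ne hc]
        rw [this]
        exact h1 s
    · intro s t' hst
      obtain ⟨c, d, hc, hd, hcd⟩ := h2 s t' hst
      exact ⟨c, d, hkeep _ _ hc, hkeep _ _ hd, hcd⟩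

theorem KConnected.conn {V : Type*} {G : SimpleGraph V} (hG : KConnected 3 G)
    {S : Set V} (hS : S.ncard < 3) : ConnS G Sᶜ :=
  (connS_iff _ _).1 (hG.2 S hS)

theorem KConnected.conn_univ {V : Type*} {G : SimpleGraph V} (hG : KConnected 3 G) :
    ConnS G Set.univ := by
  have := hG.conn (S := ∅) (by simp)
  simpa using this

theorem exists_SM {V W : Type*} [Fintype V] {G : SimpleGraph V} {H : SimpleGraph W}
    (hG : KConnected 3 G) (hH : KConnected 3 H) (hm : IsMinor H G) : ∃ f, SM G H f := by
  classical
  obtain ⟨B, hB1, hB2, hB3⟩ := hm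
  obtain ⟨w0, -⟩ := hH.conn_univ.1
  let g : V → Option W := fun a => if h : ∃ t, a ∈ B t then some h.choose else none
  have hg : ∀ a t, g a = some t ↔ a ∈ B t := by
    intro a t
    by_cases h : ∃ t, a ∈ B t
    · have e : g a = some h.choose := dif_pos h
      rw [e, Option.some_inj]
      constructor
      · rintro rfl; exact h.choose_spec
      · intro ht
        by_contra hne
        exact Set.disjoint_left.1 (hB2 _ _ hne) h.choose_spec ht
    · have e : g a = none := dif_neg h
      rw [e]
      constructor
      · simp
      · intro ht; exact absurd ⟨t, ht⟩ h
  refine exists_SM_aux hG.conn_univ ⟨w0⟩ _ g rfl ?_ ?_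
  · intro t
    have : {a | g a = some t} = B t := by ext a; exact hg a t
    rw [this]
    exact (connS_iff _ _).1 (hB1 t)
  · intro s t hst
    obtain ⟨a, ha, b, hb, hab⟩ := hB3 s t hst
    exact ⟨a, b, (hg _ _).2 ha, (hg _ _).2 hb, hab⟩

/-- In a 3-connected graph a nonempty set cannot have all its neighbours in two vertices,
if there is a further vertex. -/
theorem no_two_sep {V : Type*} {G : SimpleGraph V} (hG : KConnected 3 G) {A : Set V}
    {a x y z : V} (ha : a ∈ A) (hx : x ∉ A) (hy : y ∉ A) (hz : z ∉ A) (hzx : z ≠ x)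
    (hzy : z ≠ y) (hN : ∀ a ∈ A, ∀ b, G.Adj a b → b ∈ A ∨ b = x ∨ b = y) : False := by
  have hc : ({x, y} : Set V).ncard < 3 := pair_lt x y
  obtain ⟨c, hc, d, hd, hcA, hdA, hcd⟩ := (hG.conn hc).2 (fun b => b ∈ A)
    ⟨a, by rintro (rfl | rfl) <;> contradiction, ha⟩
    ⟨z, by rintro (rfl | rfl) <;> contradiction, hz⟩
  rcases hN c hcA d hcd with h | h | h
  · exact hdA h
  · exact hd (Or.inl h)
  · exact hd (Or.inr h)

open Classical in
theorem shift {V W : Type*} {G : SimpleGraph V} {H : SimpleGraph W} (hG : KConnected 3 G)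
    {f : V → W} (hf : SM G H f) {x y z : V} {A : Set V} {a₀ : V} (ha₀ : a₀ ∈ A)
    (hxy : G.Adj x y) (hfxy : f x = f y) (hxz : x ≠ z) (hyz : y ≠ z)
    (hx : x ∉ A) (hy : y ∉ A) (hz : z ∉ A)
    (hN : ∀ a ∈ A, ∀ b, G.Adj a b → b ∈ A ∨ b = x ∨ b = y ∨ b = z)
    (hfA : ∀ a ∈ A, f a = f x ∨ f a = f z) :
    SM G H (fun a => if a ∈ A then f z else f a) := by
  by_cases hst : f x = f z
  · have : (fun a => if a ∈ A then f z else f a) = f := by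
      funext a
      by_cases h : a ∈ A
      · rcases hfA a h with h' | h'
        · simp [h, h', hst]
        · simp [h, h']
      · simp [h]
    rw [this]; exact hf
  set f' : V → W := fun a => if a ∈ A then f z else f a with hf'
  have hin : ∀ a ∈ A, f' a = f z := fun a h => by simp [hf', h]
  have hout : ∀ a, a ∉ A → f' a = f a := fun a h => by simp [hf', h]
  have hax : ∃ a ∈ A, G.Adj a x := by
    by_contra hno
    push Not at hno
    refine no_two_sep hG ha₀ hy hz hx hxy.ne hxz ?_
    intro a ha b hab
    rcases hN a ha b hab with h | h | h | h
    · exact Or.inl h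
    · subst h; exact absurd hab (hno a ha)
    · exact Or.inr (Or.inl h)
    · exact Or.inr (Or.inr h)
  refine ⟨?_, ?_⟩
  · intro t
    by_cases ht : t = f z
    · subst ht
      refine ⟨⟨z, hout z hz⟩, ?_⟩
      intro p hp1 hp2
      -- the part of A on the other side of the cut than z
      by_contra hno
      push Not at hno
      by_cases hC : ∃ c ∈ A, ¬ (p c ↔ p z)
      · obtain ⟨c, hc, hpc⟩ := hC
        refine no_two_sep hG (A := {c | c ∈ A ∧ ¬ (p c ↔ p z)}) (a := c) (x := x) (y := y)
          (z := z) ⟨hc, hpc⟩ (fun h => hx h.1) (fun h => hy h.1) (fun h => hz h.1)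
          hxz.symm hyz.symm ?_
        rintro a ⟨ha, hpa⟩ b hab
        have key : f' b = f z → ¬ (p b ↔ p z) := by
          intro hb hpb
          by_cases h1 : p a
          · exact hno a (hin a ha) b hb h1 (by tauto) hab
          · exact hno b hb a (hin a ha) (by tauto) h1 hab.symm
        rcases hN a ha b hab with h | h | h | h
        · exact Or.inl ⟨h, key (hin b h)⟩
        · exact Or.inr (Or.inl h)
        · exact Or.inr (Or.inr h)
        · subst h
          exact absurd Iff.rfl (key (hout b hz))
      · push Not at hC
        have hrep : ∀ c, f' c = f z → ∃ c', f c' = f z ∧ c' ∉ A ∧ (p c' ↔ p c) := by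
          intro c hc
          by_cases h : c ∈ A
          · exact ⟨z, rfl, hz, (hC c h).symm⟩
          · exact ⟨c, by rw [← hout c h]; exact hc, h, Iff.rfl⟩
        obtain ⟨c, hc, hpc⟩ := hp1
        obtain ⟨d, hd, hpd⟩ := hp2
        obtain ⟨c', hc1, _, hc2⟩ := hrep c hc
        obtain ⟨d', hd1, _, hd2⟩ := hrep d hd
        obtain ⟨a, ha, b, hb, hpa, hpb, hab⟩ := (hf.1 (f z)).2 p
          ⟨c', hc1, hc2.2 hpc⟩ ⟨d', hd1, fun h => hpd (hd2.1 h)⟩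
        have hback : ∀ a, f a = f z → f' a = f z := by
          intro a ha
          by_cases h : a ∈ A
          · exact hin a h
          · rw [hout a h]; exact ha
        exact hno a (hback a ha) b (hback b hb) hpa hpb hab
    · by_cases hts : t = f x
      · subst hts
        have hset : ∀ c, f' c = f x ↔ f c = f x ∧ c ∉ A := by
          intro c
          by_cases h : c ∈ A
          · rw [hin c h]; constructor
            · intro h'; exact absurd h'.symm hst
            · rintro ⟨_, h'⟩; exact absurd h h'
          · rw [hout c h]; simp [h]
        refine ⟨⟨x, hout x hx⟩, ?_⟩
        rintro p ⟨c, hc, hpc⟩ ⟨d, hd, hpd⟩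
        have hc' := (hset c).1 hc
        have hd' := (hset d).1 hd
        have hxm : f' x = f x := hout x hx
        have hym : f' y = f x := by rw [hout y hy, hfxy]
        obtain ⟨a, ha, b, hb, hqa, hqb, hab⟩ := (hf.1 (f x)).2
          (fun a => if a ∈ A then p x else p a)
          ⟨c, hc'.1, by simpa [hc'.2] using hpc⟩ ⟨d, hd'.1, by simpa [hd'.2] using hpd⟩
        simp only [Set.mem_setOf_eq] at ha hb
        by_cases haA : a ∈ A
        · simp only [haA, if_true] at hqa
          by_cases hbA : b ∈ A
          · simp only [hbA, if_true] at hqb; exact absurd hqa hqb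
          · simp only [hbA, if_false] at hqb
            rcases hN a haA b hab with h | h | h | h
            · exact absurd h hbA
            · subst h; exact absurd hqa hqb
            · subst h; exact ⟨x, hxm, b, hym, hqa, hqb, hxy⟩
            · subst h; exact absurd hb.symm hst
        · simp only [haA, if_false] at hqa
          by_cases hbA : b ∈ A
          · simp only [hbA, if_true] at hqb
            rcases hN b hbA a hab.symm with h | h | h | h
            · exact absurd h haA
            · subst h; exact absurd hqa hqb
            · subst h; exact ⟨a, hym, x, hxm, hqa, hqb, hxy.symm⟩
            · subst h; exact absurd ha.symm hst
          · simp only [hbA, if_false] at hqb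
            exact ⟨a, (hset a).2 ⟨ha, haA⟩, b, (hset b).2 ⟨hb, hbA⟩, hqa, hqb, hab⟩
      · have : {a | f' a = t} = {a | f a = t} := by
          ext c
          simp only [Set.mem_setOf_eq]
          by_cases h : c ∈ A
          · rw [hin c h]
            constructor
            · intro h'; exact absurd h'.symm ht
            · intro h'
              rcases hfA c h with h2 | h2
              · exact absurd (h'.symm.trans h2) hts
              · exact absurd (h'.symm.trans h2) ht
          · rw [hout c h]
        rw [this]; exact hf.1 t
  · intro s t hadj
    obtain ⟨a, b, ha, hb, hab⟩ := hf.2 s t hadj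
    have hne : s ≠ t := hadj.ne
    obtain ⟨a1, ha1, ha1x⟩ := hax
    by_cases h1 : (s = f x ∧ t = f z)
    · exact ⟨x, a1, by rw [hout x hx, h1.1], by rw [hin a1 ha1, h1.2], ha1x.symm⟩
    by_cases h2 : (s = f z ∧ t = f x)
    · exact ⟨a1, x, by rw [hin a1 ha1, h2.1], by rw [hout x hx, h2.2], ha1x⟩
    -- if a vertex lies in `A` with old value `f x`, its neighbour has value `f x` or `f z`
    have aux : ∀ a b, G.Adj a b → f a ≠ f b → ¬ (f a = f x ∧ f b = f z) → f' a = f a := by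
      intro a b hab hne hnot
      by_cases h : a ∈ A
      · rw [hin a h]
        rcases hfA a h with h3 | h3
        · exfalso
          rcases hN a h b hab with h4 | h4 | h4 | h4
          · rcases hfA b h4 with h5 | h5
            · exact hne (h3.trans h5.symm)
            · exact hnot ⟨h3, h5⟩
          · subst h4; exact hne h3
          · subst h4; exact hne (h3.trans hfxy)
          · subst h4; exact hnot ⟨h3, rfl⟩
        · exact h3.symm
      · exact hout a h
    subst ha hb
    exact ⟨a, b, aux a b hab hne h1, aux b a hab.symm hne.symm (fun h => h2 ⟨h.2, h.1⟩), hab⟩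

theorem contract_adj {V : Type*} {G : SimpleGraph V} {u v : V} {a b : {w : V // w ≠ v}}
    (hne : a ≠ b)
    (h : G.Adj a.1 b.1 ∨ (a.1 = u ∧ G.Adj v b.1) ∨ (b.1 = u ∧ G.Adj v a.1)) :
    (ContractEdge G u v).Adj a b := by
  unfold ContractEdge
  rw [SimpleGraph.fromRel_adj]
  exact ⟨hne, Or.inl h⟩

/-- The contraction either is 3-connected or comes with a 3-separation of `G`. -/
theorem contract_or {V : Type*} [Fintype V] {G : SimpleGraph V} (hG : KConnected 3 G)
    (hcard : 4 < Nat.card V) {u v : V} (huv : G.Adj u v) :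
    KConnected 3 (ContractEdge G u v) ∨
    ∃ (w : V) (p : V → Prop), w ≠ u ∧ w ≠ v ∧ (∃ a, a ≠ u ∧ a ≠ v ∧ a ≠ w ∧ p a) ∧
      (∃ a, a ≠ u ∧ a ≠ v ∧ a ≠ w ∧ ¬ p a) ∧
      ∀ a b, a ≠ u → a ≠ v → a ≠ w → b ≠ u → b ≠ v → b ≠ w → p a → ¬ p b → ¬ G.Adj a b := by
  classical
  by_contra hcon
  push Not at hcon
  obtain ⟨hnot, hsep⟩ := hcon
  apply hnot
  have hcard' : 3 < Nat.card {w : V // w ≠ v} := by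
    rw [Nat.card_eq_fintype_card] at hcard ⊢
    rw [Fintype.card_subtype_compl, Fintype.card_subtype_eq]
    omega
  refine ⟨hcard', ?_⟩
  intro S hS
  rw [connS_iff]
  refine ⟨?_, ?_⟩
  · rw [Set.nonempty_compl]
    rintro rfl
    rw [Set.ncard_univ] at hS
    omega
  rintro p ⟨c, hc, hpc⟩ ⟨d, hd, hpd⟩
  by_cases hu : (⟨u, huv.ne⟩ : {w : V // w ≠ v}) ∈ S
  · -- `u ∈ S`
    have key : ∃ a b : {w : V // w ≠ v}, a ∉ S ∧ b ∉ S ∧ p a ∧ ¬ p b ∧ G.Adj a.1 b.1 := by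
      by_cases h1 : ∃ w ∈ S, w.1 ≠ u
      · obtain ⟨w, hwS, hwu⟩ := h1
        have hnS : ∀ x : {w : V // w ≠ v}, x.1 ≠ u → x.1 ≠ w.1 → x ∉ S := by
          intro x hxu hxw hxS
          have : ({x, w, ⟨u, huv.ne⟩} : Set {w : V // w ≠ v}).ncard ≤ S.ncard := by
            apply Set.ncard_le_ncard _ (Set.toFinite _)
            rintro y (rfl | rfl | rfl) <;> assumption
          rw [Set.ncard_eq_three.2 ⟨x, w, ⟨u, huv.ne⟩, fun h => hxw (congrArg _ h),
            fun h => hxu (congrArg _ h), fun h => hwu (congrArg _ h), rfl⟩] at this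
          omega
        have hS' : ∀ x : {w : V // w ≠ v}, x ∉ S → x.1 ≠ u ∧ x.1 ≠ w.1 := by
          intro x hx
          constructor
          · rintro rfl; exact hx hu
          · intro h; exact hx ((Subtype.ext h : x = w) ▸ hwS)
        obtain ⟨a, b, ha1, ha2, ha3, hb1, hb2, hb3, hpa, hpb, hab⟩ :=
          hsep w.1 (fun x => ∃ h : x ≠ v, p ⟨x, h⟩) hwu w.2
          ⟨c.1, (hS' c hc).1, c.2, (hS' c hc).2, c.2, hpc⟩
          ⟨d.1, (hS' d hd).1, d.2, (hS' d hd).2, fun ⟨_, h⟩ => hpd h⟩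
        obtain ⟨_, hpa⟩ := hpa
        exact ⟨⟨a, ha2⟩, ⟨b, hb2⟩, hnS _ ha1 ha3, hnS _ hb1 hb3, hpa,
          fun h => hpb ⟨hb2, h⟩, hab⟩
      · push Not at h1
        have hS' : ∀ x : {w : V // w ≠ v}, x ∉ S → x.1 ∈ ({u, v} : Set V)ᶜ := by
          intro x hx
          rintro (h | h)
          · exact hx ((Subtype.ext h : x = ⟨u, huv.ne⟩) ▸ hu)
          · exact x.2 h
        obtain ⟨a, ha, b, hb, hpa, hpb, hab⟩ :=
          (hG.conn (S := {u, v}) (pair_lt u v)).2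
          (fun x => ∃ h : x ≠ v, p ⟨x, h⟩) ⟨c.1, hS' c hc, c.2, hpc⟩
          ⟨d.1, hS' d hd, fun ⟨_, h⟩ => hpd h⟩
        have hav : a ≠ v := fun h => ha (Or.inr h)
        have hbv : b ≠ v := fun h => hb (Or.inr h)
        obtain ⟨_, hpa⟩ := hpa
        exact ⟨⟨a, hav⟩, ⟨b, hbv⟩, fun h => ha (Or.inl (h1 _ h)), fun h => hb (Or.inl (h1 _ h)),
          hpa, fun h => hpb ⟨hbv, h⟩, hab⟩
    obtain ⟨a, b, ha, hb, hpa, hpb, hab⟩ := key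
    refine ⟨a, ha, b, hb, hpa, hpb, contract_adj ?_ (Or.inl hab)⟩
    rintro rfl; exact hpb hpa
  · -- `u ∉ S`
    let π : V → {w : V // w ≠ v} := fun x => if h : x = v then ⟨u, huv.ne⟩ else ⟨x, h⟩
    have hπv : π v = ⟨u, huv.ne⟩ := by simp [π]
    have hπ : ∀ x (h : x ≠ v), π x = ⟨x, h⟩ := fun x h => by simp [π, h]
    have hS' : (Subtype.val '' S).ncard < 3 :=
      lt_of_le_of_lt (Set.ncard_image_le (Set.toFinite _)) hS
    have hmem : ∀ x : {w : V // w ≠ v}, x ∉ S → x.1 ∈ (Subtype.val '' S)ᶜ := by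
      rintro x hx ⟨y, hy, hyx⟩
      exact hx ((Subtype.ext hyx : y = x) ▸ hy)
    have hmem' : ∀ x, x ∈ (Subtype.val '' S)ᶜ → π x ∉ S := by
      intro x hx
      by_cases h : x = v
      · rw [h, hπv]; exact hu
      · rw [hπ x h]; exact fun h' => hx ⟨_, h', rfl⟩
    obtain ⟨a, ha, b, hb, hpa, hpb, hab⟩ := (hG.conn hS').2 (fun x => p (π x))
      ⟨c.1, hmem c hc, by rw [hπ c.1 c.2]; exact hpc⟩
      ⟨d.1, hmem d hd, by rw [hπ d.1 d.2]; exact hpd⟩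
    refine ⟨π a, hmem' a ha, π b, hmem' b hb, hpa, hpb, contract_adj ?_ ?_⟩
    · intro h; rw [h] at hpa; exact hpb hpa
    · by_cases h1 : a = v
      · by_cases h2 : b = v
        · subst h1; subst h2; exact absurd hab (G.irrefl)
        · rw [h1, hπv, hπ b h2]; right; left; exact ⟨rfl, h1 ▸ hab⟩
      · by_cases h2 : b = v
        · rw [h2, hπv, hπ a h1]; right; right; exact ⟨rfl, h2 ▸ hab.symm⟩
        · rw [hπ a h1, hπ b h2]; left; exact hab

theorem contract_minor {V W : Type*} {G : SimpleGraph V} {H : SimpleGraph W} {f : V → W}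
    (hf : SM G H f) {u v : V} (huv : G.Adj u v) (hfuv : f u = f v) :
    IsMinor H (ContractEdge G u v) := by
  classical
  let π : V → {w : V // w ≠ v} := fun x => if h : x = v then ⟨u, huv.ne⟩ else ⟨x, h⟩
  have hπv : π v = ⟨u, huv.ne⟩ := by simp [π]
  have hπ : ∀ x (h : x ≠ v), π x = ⟨x, h⟩ := fun x h => by simp [π, h]
  have hfπ : ∀ x, f (π x).1 = f x := by
    intro x
    by_cases h : x = v
    · rw [h, hπv]; exact hfuv
    · rw [hπ x h]
  have hadj : ∀ a b, G.Adj a b → π a ≠ π b → (ContractEdge G u v).Adj (π a) (π b) := by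
    intro a b hab hne
    refine contract_adj hne ?_
    by_cases h1 : a = v
    · by_cases h2 : b = v
      · subst h1; subst h2; exact absurd hab (G.irrefl)
      · rw [h1, hπv, hπ b h2]; right; left; exact ⟨rfl, h1 ▸ hab⟩
    · by_cases h2 : b = v
      · rw [h2, hπv, hπ a h1]; right; right; exact ⟨rfl, h2 ▸ hab.symm⟩
      · rw [hπ a h1, hπ b h2]; left; exact hab
  apply SM.isMinor (f := fun x : {w : V // w ≠ v} => f x.1)
  refine ⟨?_, ?_⟩
  · intro t
    refine ⟨?_, ?_⟩
    · obtain ⟨a, ha⟩ := (hf.1 t).1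
      exact ⟨π a, (hfπ a).trans ha⟩
    · rintro p ⟨c, hc, hpc⟩ ⟨d, hd, hpd⟩
      obtain ⟨a, ha, b, hb, hpa, hpb, hab⟩ := (hf.1 t).2 (fun x => p (π x))
        ⟨c.1, hc, by rw [hπ c.1 c.2]; exact hpc⟩ ⟨d.1, hd, by rw [hπ d.1 d.2]; exact hpd⟩
      refine ⟨π a, (hfπ a).trans ha, π b, (hfπ b).trans hb, hpa, hpb, hadj a b hab ?_⟩
      intro h; rw [h] at hpa; exact hpb hpa
  · intro s t hst
    obtain ⟨a, b, ha, hb, hab⟩ := hf.2 s t hst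
    refine ⟨π a, π b, (hfπ a).trans ha, (hfπ b).trans hb, hadj a b hab ?_⟩
    intro h
    apply hst.ne
    rw [← ha, ← hb, ← hfπ a, ← hfπ b, h]

/-- The descent: minimal separated set gives a good contractible edge. -/
theorem descent {V W : Type*} [Fintype V] {G : SimpleGraph V} {H : SimpleGraph W}
    (hG : KConnected 3 G) (hcard : 4 < Nat.card V) (n : ℕ) :
    ∀ (A : Set V), A.ncard = n → ∀ (x y z a₀ : V) (f : V → W), a₀ ∈ A → SM G H f →
      G.Adj x y → x ≠ z → y ≠ z → x ∉ A → y ∉ A → z ∉ A →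
      (∀ a ∈ A, ∀ b, G.Adj a b → b ∈ A ∨ b = x ∨ b = y ∨ b = z) →
      (∀ a ∈ A, f a = f z) →
      ∃ u v, G.Adj u v ∧ KConnected 3 (ContractEdge G u v) ∧ IsMinor H (ContractEdge G u v) := by
  classical
  induction n using Nat.strong_induction_on with
  | _ n ih =>
  intro A hAn x y z a₀ f ha₀ hf hxy hxz hyz hx hy hz hN hfA
  have haz : ∃ v ∈ A, G.Adj v z := by
    by_contra hno
    push Not at hno
    refine no_two_sep hG ha₀ hx hy hz hxz.symm hyz.symm ?_
    intro a ha b hab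
    rcases hN a ha b hab with h | h | h | h
    · exact Or.inl h
    · exact Or.inr (Or.inl h)
    · exact Or.inr (Or.inr h)
    · subst h; exact absurd hab (hno a ha)
  obtain ⟨v, hvA, hvz⟩ := haz
  have hzv := hvz.symm
  have hfzv : f z = f v := (hfA v hvA).symm
  rcases contract_or hG hcard hzv with h | ⟨w, p, hwz, hwv, hp1, hp2, hsep⟩
  · exact ⟨z, v, hzv, h, contract_minor hf hzv hfzv⟩
  -- choose the side `D` avoiding `x` and `y`
  have hxv : x ≠ v := by rintro rfl; exact hx hvA
  have hyv : y ≠ v := by rintro rfl; exact hy hvA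
  have hD : ∃ D : Set V, (∃ d, d ∈ D) ∧ z ∉ D ∧ v ∉ D ∧ w ∉ D ∧ x ∉ D ∧ y ∉ D ∧
      ∀ a ∈ D, ∀ b, G.Adj a b → b ∈ D ∨ b = z ∨ b = v ∨ b = w := by
    by_cases hside : (x ≠ w ∧ p x) ∨ (y ≠ w ∧ p y)
    · have hnx : x ≠ w → ¬ ¬ p x := by
        intro h1 h2
        rcases hside with h | h
        · exact h2 h.2
        · exact hsep y x hyz hyv h.1 hxz hxv h1 h.2 h2 hxy.symm
      have hny : y ≠ w → ¬ ¬ p y := by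
        intro h1 h2
        rcases hside with h | h
        · exact hsep x y hxz hxv h.1 hyz hyv h1 h.2 h2 hxy
        · exact h2 h.2
      obtain ⟨d, hd1, hd2, hd3, hd⟩ := hp2
      refine ⟨{a | a ≠ z ∧ a ≠ v ∧ a ≠ w ∧ ¬ p a}, ⟨d, hd1, hd2, hd3, hd⟩, fun h => h.1 rfl,
        fun h => h.2.1 rfl, fun h => h.2.2.1 rfl, fun h => hnx h.2.2.1 h.2.2.2,
        fun h => hny h.2.2.1 h.2.2.2, ?_⟩
      rintro a ⟨h1, h2, h3, h4⟩ b hab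
      by_contra hb
      push Not at hb
      obtain ⟨hb1, hb2, hb3, hb4⟩ := hb
      by_cases hpb : p b
      · exact hsep b a hb2 hb3 hb4 h1 h2 h3 hpb h4 hab.symm
      · exact hb1 ⟨hb2, hb3, hb4, hpb⟩
    · push Not at hside
      obtain ⟨d, hd1, hd2, hd3, hd⟩ := hp1
      refine ⟨{a | a ≠ z ∧ a ≠ v ∧ a ≠ w ∧ p a}, ⟨d, hd1, hd2, hd3, hd⟩, fun h => h.1 rfl,
        fun h => h.2.1 rfl, fun h => h.2.2.1 rfl, fun h => hside.1 h.2.2.1 h.2.2.2,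
        fun h => hside.2 h.2.2.1 h.2.2.2, ?_⟩
      rintro a ⟨h1, h2, h3, h4⟩ b hab
      by_contra hb
      push Not at hb
      obtain ⟨hb1, hb2, hb3, hb4⟩ := hb
      by_cases hpb : p b
      · exact hb1 ⟨hb2, hb3, hb4, hpb⟩
      · exact hsep a b h1 h2 h3 hb2 hb3 hb4 h4 hpb hab
  obtain ⟨D, ⟨d, hd⟩, hzD, hvD, hwD, hxD, hyD, hND⟩ := hD
  have hvn : ∃ b ∈ D, G.Adj b v := by
    by_contra hno
    push Not at hno
    refine no_two_sep hG hd hzD hwD hvD hvz.ne hwv.symm ?_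
    intro a ha b hab
    rcases hND a ha b hab with h | h | h | h
    · exact Or.inl h
    · exact Or.inr (Or.inl h)
    · subst h; exact absurd hab (hno a ha)
    · exact Or.inr (Or.inr h)
  obtain ⟨b₀, hb₀, hb₀v⟩ := hvn
  have hb₀A : b₀ ∈ A := by
    rcases hN v hvA b₀ hb₀v.symm with h | h | h | h
    · exact h
    · subst h; exact absurd hb₀ hxD
    · subst h; exact absurd hb₀ hyD
    · subst h; exact absurd hb₀ hzD
  have hNDA : ∀ a ∈ D ∩ A, ∀ b, G.Adj a b → b ∈ D ∩ A ∨ b = z ∨ b = v ∨ b = w := by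
    rintro a ⟨haD, haA⟩ b hab
    rcases hND a haD b hab with h | h
    · left
      refine ⟨h, ?_⟩
      rcases hN a haA b hab with h' | h' | h' | h'
      · exact h'
      · subst h'; exact absurd h hxD
      · subst h'; exact absurd h hyD
      · subst h'; exact absurd h hzD
    · exact Or.inr h
  have hnz : z ∉ D ∩ A := fun h => hzD h.1
  have hnv : v ∉ D ∩ A := fun h => hvD h.1
  have hnw : w ∉ D ∩ A := fun h => hwD h.1
  have hf' := shift hG hf (A := D ∩ A) ⟨hb₀, hb₀A⟩ hzv hfzv hwz.symm hwv.symm hnz hnv hnw hNDA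
    (fun a ha => Or.inl (hfA a ha.2))
  refine ih (D ∩ A).ncard ?_ (D ∩ A) rfl z v w b₀ _ ⟨hb₀, hb₀A⟩ hf' hzv hwz.symm hwv.symm
    hnz hnv hnw hNDA ?_
  · rw [← hAn]
    apply Set.ncard_lt_ncard _ (Set.toFinite _)
    refine ⟨Set.inter_subset_right, fun h => hvD (h hvA).1⟩
  · intro a ha
    simp only [if_pos ha, if_neg hnw]

theorem exists_contract {V W : Type*} [Fintype V] [Fintype W] {G : SimpleGraph V}
    {H : SimpleGraph W} (hG : KConnected 3 G) (hH : KConnected 3 H)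
    (hcard : Fintype.card W < Fintype.card V) {f : V → W} (hf : SM G H f) :
    ∃ u v, G.Adj u v ∧ KConnected 3 (ContractEdge G u v) ∧ IsMinor H (ContractEdge G u v) := by
  classical
  have hcard4 : 4 < Nat.card V := by
    have := hH.1
    rw [Nat.card_eq_fintype_card] at this ⊢
    omega
  obtain ⟨a, b, hab, hfab⟩ := Fintype.exists_ne_map_eq_of_card_lt f hcard
  obtain ⟨x, hx, y, hy, -, -, hxy⟩ := (hf.1 (f a)).2 (fun c => c = a) ⟨a, rfl, rfl⟩
    ⟨b, hfab.symm, fun h => hab h.symm⟩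
  have hfxy : f x = f y := hx.trans hy.symm
  rcases contract_or hG hcard4 hxy with h | ⟨w, p, hwx, hwy, hp1, hp2, hsep⟩
  · exact ⟨x, y, hxy, h, contract_minor hf hxy hfxy⟩
  have hA : ∃ A : Set V, (∃ d, d ∈ A) ∧ x ∉ A ∧ y ∉ A ∧ w ∉ A ∧
      (∀ a ∈ A, f a = f x ∨ f a = f w) ∧
      ∀ a ∈ A, ∀ b, G.Adj a b → b ∈ A ∨ b = x ∨ b = y ∨ b = w := by
    by_cases hgood : ∀ a, a ≠ x → a ≠ y → a ≠ w → p a → f a = f x ∨ f a = f w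
    · obtain ⟨d, hd1, hd2, hd3, hd⟩ := hp1
      refine ⟨{a | a ≠ x ∧ a ≠ y ∧ a ≠ w ∧ p a}, ⟨d, hd1, hd2, hd3, hd⟩, fun h => h.1 rfl,
        fun h => h.2.1 rfl, fun h => h.2.2.1 rfl,
        fun a h => hgood a h.1 h.2.1 h.2.2.1 h.2.2.2, ?_⟩
      rintro a ⟨h1, h2, h3, h4⟩ b hab
      by_contra hb
      push Not at hb
      obtain ⟨hb1, hb2, hb3, hb4⟩ := hb
      by_cases hpb : p b
      · exact hb1 ⟨hb2, hb3, hb4, hpb⟩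
      · exact hsep a b h1 h2 h3 hb2 hb3 hb4 h4 hpb hab
    · push Not at hgood
      obtain ⟨c, hc1, hc2, hc3, hpc, hcx, hcw⟩ := hgood
      obtain ⟨d, hd1, hd2, hd3, hd⟩ := hp2
      refine ⟨{a | a ≠ x ∧ a ≠ y ∧ a ≠ w ∧ ¬ p a}, ⟨d, hd1, hd2, hd3, hd⟩, fun h => h.1 rfl,
        fun h => h.2.1 rfl, fun h => h.2.2.1 rfl, ?_, ?_⟩
      · rintro e ⟨he1, he2, he3, he⟩
        by_contra hee
        push Not at hee
        -- vertices whose image avoids `f x`, `f w` are not in the separator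
        have hav : ∀ a, f a ≠ f x → f a ≠ f w → a ≠ x ∧ a ≠ y ∧ a ≠ w := by
          intro a h1 h2
          refine ⟨?_, ?_, ?_⟩
          · rintro rfl; exact h1 rfl
          · rintro rfl; exact h1 hfxy.symm
          · rintro rfl; exact h2 rfl
        have hside : ∀ a b, f a ≠ f x → f a ≠ f w → f b ≠ f x → f b ≠ f w → G.Adj a b →
            p a → p b := by
          intro a b h1 h2 h3 h4 hab hpa
          by_contra hpb
          obtain ⟨i1, i2, i3⟩ := hav a h1 h2
          obtain ⟨j1, j2, j3⟩ := hav b h3 h4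
          exact hsep a b i1 i2 i3 j1 j2 j3 hpa hpb hab
        have hfib : ∀ a b, f a ≠ f x → f a ≠ f w → f a = f b → p a → p b := by
          intro a b h1 h2 hfab hpa
          by_contra hpb
          obtain ⟨a', ha', b', hb', hpa', hpb', hab'⟩ :=
            (hf.1 (f a)).2 p ⟨a, rfl, hpa⟩ ⟨b, hfab.symm, hpb⟩
          simp only [Set.mem_setOf_eq] at ha' hb'
          exact hpb' (hside a' b' (ha' ▸ h1) (ha' ▸ h2) (hb' ▸ h1) (hb' ▸ h2) hab' hpa')
        obtain ⟨s, hs, t, ht, ⟨a, hfa, hpa⟩, hnt, hst⟩ :=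
          (hH.conn (S := {f x, f w}) (pair_lt _ _)).2
          (fun s => ∃ a, f a = s ∧ p a)
          ⟨f c, by rintro (h | h) <;> contradiction, c, rfl, hpc⟩
          ⟨f e, by rintro (h | h); exacts [hee.1 h, hee.2 h],
            fun ⟨a, hfa, hpa⟩ => he (hfib a e (hfa ▸ hee.1) (hfa ▸ hee.2) hfa hpa)⟩
        obtain ⟨i, j, hi, hj, hij⟩ := hf.2 s t hst
        have hs1 : s ≠ f x := fun h => hs (Or.inl h)
        have hs2 : s ≠ f w := fun h => hs (Or.inr h)
        have ht1 : t ≠ f x := fun h => ht (Or.inl h)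
        have ht2 : t ≠ f w := fun h => ht (Or.inr h)
        have hpi : p i := hfib a i (hfa ▸ hs1) (hfa ▸ hs2) (hfa.trans hi.symm) hpa
        exact hnt ⟨j, hj, hside i j (hi ▸ hs1) (hi ▸ hs2) (hj ▸ ht1) (hj ▸ ht2) hij hpi⟩
      · rintro a ⟨h1, h2, h3, h4⟩ b hab
        by_contra hb
        push Not at hb
        obtain ⟨hb1, hb2, hb3, hb4⟩ := hb
        by_cases hpb : p b
        · exact hsep b a hb2 hb3 hb4 h1 h2 h3 hpb h4 hab.symm
        · exact hb1 ⟨hb2, hb3, hb4, hpb⟩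
  obtain ⟨A, ⟨d, hd⟩, hxA, hyA, hwA, hfA, hN⟩ := hA
  have hf' := shift hG hf hd hxy hfxy hwx.symm hwy.symm hxA hyA hwA hN hfA
  refine descent hG hcard4 _ A rfl x y w d _ hd hf' hxy hwx.symm hwy.symm hxA hyA hwA hN ?_
  intro a ha
  simp only [if_pos ha, if_neg hwA]

theorem kconn_of_equiv {V W : Type*} {G : SimpleGraph V} {H : SimpleGraph W} (e : W ≃ V)
    (h : ∀ a b, H.Adj a b → G.Adj (e a) (e b)) (hH : KConnected 3 H) : KConnected 3 G := by
  refine ⟨by rw [← Nat.card_congr e]; exact hH.1, ?_⟩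
  intro S hS
  rw [connS_iff]
  have hS' : (e ⁻¹' S).ncard < 3 := by
    rw [← Set.ncard_image_of_injective _ e.injective, Set.image_preimage_eq _ e.surjective]
    exact hS
  have hc := hH.conn hS'
  refine ⟨?_, ?_⟩
  · obtain ⟨a, ha⟩ := hc.1
    exact ⟨e a, ha⟩
  · rintro p ⟨c, hc1, hpc⟩ ⟨d, hd1, hpd⟩
    obtain ⟨a, ha, b, hb, hpa, hpb, hab⟩ := hc.2 (fun a => p (e a))
      ⟨e.symm c, by simpa using hc1, by simpa using hpc⟩
      ⟨e.symm d, by simpa using hd1, by simpa using hpd⟩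
    exact ⟨e a, ha, e b, hb, hpa, hpb, h a b hab⟩

theorem minor_of_iso {V V' W : Type*} {G : SimpleGraph V} {G' : SimpleGraph V'}
    {H : SimpleGraph W} (e : G ≃g G') (h : IsMinor H G) : IsMinor H G' := by
  obtain ⟨B, h1, h2, h3⟩ := h
  refine ⟨fun t => e '' B t, ?_, ?_, ?_⟩
  · intro t
    rw [connS_iff]
    have hc := (connS_iff _ _).1 (h1 t)
    refine ⟨hc.1.image _, ?_⟩
    rintro p ⟨_, ⟨c, hc1, rfl⟩, hpc⟩ ⟨_, ⟨d, hd1, rfl⟩, hpd⟩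
    obtain ⟨a, ha, b, hb, hpa, hpb, hab⟩ := hc.2 (fun a => p (e a)) ⟨c, hc1, hpc⟩ ⟨d, hd1, hpd⟩
    exact ⟨e a, ⟨a, ha, rfl⟩, e b, ⟨b, hb, rfl⟩, hpa, hpb, e.map_rel_iff.2 hab⟩
  · intro s t hst
    exact (Set.disjoint_image_iff e.injective).2 (h2 s t hst)
  · intro s t hst
    obtain ⟨a, ha, b, hb, hab⟩ := h3 s t hst
    exact ⟨e a, ⟨a, ha, rfl⟩, e b, ⟨b, hb, rfl⟩, e.map_rel_iff.2 hab⟩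

/-- There is a sequence of 3-connected graphs from `X` to `H`. -/
def HasSeq {W : Type*} (H : SimpleGraph W) (X : (m : ℕ) × SimpleGraph (Fin m)) : Prop :=
  ∃ (k : ℕ) (Gs : Fin (k + 1) → (m : ℕ) × SimpleGraph (Fin m)),
    Gs 0 = X ∧ Nonempty (H ≃g (Gs (Fin.last k)).2) ∧
    (∀ i, KConnected 3 (Gs i).2) ∧
    (∀ i : Fin k, MinorStep (Gs i.castSucc).2 (Gs i.succ).2)

theorem HasSeq.cons {W : Type*} {H : SimpleGraph W} {X Y : (m : ℕ) × SimpleGraph (Fin m)}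
    (hX : KConnected 3 X.2) (hXY : MinorStep X.2 Y.2) (hY : HasSeq H Y) : HasSeq H X := by
  obtain ⟨k, Gs, h0, hl, hc, hs⟩ := hY
  refine ⟨k + 1, Fin.cons X Gs, by simp, ?_, ?_, ?_⟩
  · rw [← Fin.succ_last, Fin.cons_succ]; exact hl
  · intro i
    refine Fin.cases ?_ ?_ i
    · exact hX
    · intro j; rw [Fin.cons_succ]; exact hc j
  · intro i
    refine Fin.cases ?_ ?_ i
    · rw [Fin.cons_succ, Fin.castSucc_zero, Fin.cons_zero, h0]; exact hXY
    · intro j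
      rw [Fin.cons_succ, ← Fin.succ_castSucc, Fin.cons_succ]; exact hs j

theorem hasSeq_of_embed {W : Type*} {H : SimpleGraph W} (hH : KConnected 3 H) {n : ℕ}
    (e : W ≃ Fin n) (k : ℕ) : ∀ G : SimpleGraph (Fin n), G.edgeSet.ncard = k →
      (∀ a b, H.Adj a b → G.Adj (e a) (e b)) → HasSeq H ⟨n, G⟩ := by
  induction k using Nat.strong_induction_on with
  | _ k ih =>
  intro G hk hHG
  have hG : KConnected 3 G := kconn_of_equiv e hHG hH
  by_cases hall : ∀ a b, G.Adj (e a) (e b) → H.Adj a b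
  · exact ⟨0, fun _ => ⟨n, G⟩, rfl, ⟨⟨e, fun {a b} => ⟨hall a b, hHG a b⟩⟩⟩, fun _ => hG,
      fun i => i.elim0⟩
  · push Not at hall
    obtain ⟨a, b, hab, hnot⟩ := hall
    have hlt : (G.deleteEdges {s(e a, e b)}).edgeSet.ncard < k := by
      rw [← hk]
      apply Set.ncard_lt_ncard _ (Set.toFinite _)
      rw [SimpleGraph.edgeSet_deleteEdges]
      refine ⟨Set.diff_subset, fun h => ?_⟩
      exact (h (show s(e a, e b) ∈ G.edgeSet from hab)).2 rfl
    have hHG' : ∀ c d, H.Adj c d → (G.deleteEdges {s(e a, e b)}).Adj (e c) (e d) := by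
      intro c d hcd
      rw [SimpleGraph.deleteEdges_adj]
      refine ⟨hHG c d hcd, ?_⟩
      intro h
      rw [Set.mem_singleton_iff, Sym2.eq_iff] at h
      rcases h with ⟨h1, h2⟩ | ⟨h1, h2⟩
      · rw [e.injective h1, e.injective h2] at hcd; exact hnot hcd
      · rw [e.injective h1, e.injective h2] at hcd; exact hnot hcd.symm
    exact HasSeq.cons (X := ⟨n, G⟩) (Y := ⟨n, G.deleteEdges {s(e a, e b)}⟩) hG
      (Or.inl ⟨s(e a, e b), hab, ⟨SimpleGraph.Iso.refl⟩⟩) (ih _ hlt _ rfl hHG')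

theorem hasSeq {W : Type*} [Fintype W] {H : SimpleGraph W} (hH : KConnected 3 H) (n : ℕ) :
    ∀ G : SimpleGraph (Fin n), KConnected 3 G → IsMinor H G → HasSeq H ⟨n, G⟩ := by
  classical
  induction n with
  | zero =>
    intro G hG
    have := hG.1
    simp at this
  | succ n ih =>
    intro G hG hm
    obtain ⟨f, hf⟩ := exists_SM hG hH hm
    have hsurj : Function.Surjective f := fun t => (hf.1 t).1
    by_cases hcard : Fintype.card W < Fintype.card (Fin (n + 1))
    · obtain ⟨u, v, huv, h3, hmin⟩ := exists_contract hG hH hcard hf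
      have hcn : Fintype.card {w : Fin (n + 1) // w ≠ v} = n := by
        rw [Fintype.card_subtype_compl, Fintype.card_subtype_eq]; simp
      let e := Fintype.equivFinOfCardEq hcn
      let iso : ContractEdge G u v ≃g (ContractEdge G u v).map e.toEmbedding :=
        SimpleGraph.Iso.map e _
      refine HasSeq.cons (Y := ⟨n, (ContractEdge G u v).map e.toEmbedding⟩) hG
        (Or.inr ⟨u, v, huv, ⟨iso.symm⟩⟩) (ih _ ?_ (minor_of_iso iso hmin))
      exact kconn_of_equiv iso.toEquiv (fun a b h => iso.map_rel_iff.2 h) h3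
    · have hbij : Function.Bijective f :=
        (Fintype.bijective_iff_surjective_and_card f).2
          ⟨hsurj, le_antisymm (not_lt.1 hcard) (Fintype.card_le_of_surjective f hsurj)⟩
      let e := Equiv.ofBijective f hbij
      refine hasSeq_of_embed hH e.symm _ G rfl ?_
      intro a b hab
      obtain ⟨i, j, rfl, rfl, hij⟩ := hf.2 a b hab
      have h1 : e.symm (f i) = i := e.symm_apply_apply i
      have h2 : e.symm (f j) = j := e.symm_apply_apply j
      rw [h1, h2]; exact hij

/-- Lemma 7, splitter-type theorem: if a 3-connected graph `H` is a
minor of a 3-connected graph `G`, then there is a sequence of 3-connected graphs from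
`G` to `H`, each obtained from the previous by deleting or contracting a single edge. -/
theorem splitter_sequence {V W : Type*} [Fintype V] [Fintype W]
    (G : SimpleGraph V) (H : SimpleGraph W)
    (hG : KConnected 3 G) (hH : KConnected 3 H) (hm : IsMinor H G) :
    ∃ (k : ℕ) (Gs : Fin (k + 1) → (m : ℕ) × SimpleGraph (Fin m)),
      Nonempty (G ≃g (Gs 0).2) ∧ Nonempty (H ≃g (Gs (Fin.last k)).2) ∧
      (∀ i, KConnected 3 (Gs i).2) ∧
      (∀ i : Fin k, MinorStep (Gs i.castSucc).2 (Gs i.succ).2) := by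
  let e := Fintype.equivFin V
  let iso : G ≃g G.map e.toEmbedding := SimpleGraph.Iso.map e _
  obtain ⟨k, Gs, h0, hl, hc, hs⟩ := hasSeq hH _ (G.map e.toEmbedding)
    (kconn_of_equiv iso.toEquiv (fun a b h => iso.map_rel_iff.2 h) hG) (minor_of_iso iso hm)
  exact ⟨k, Gs, by rw [h0]; exact ⟨iso⟩, hl, hc, hs⟩

end K24Paper
end

section
/- The graphs C, B⁺, B, A⁺, A, and K_{3,3} are all K_{2,4}-minor-free. -/
namespace K24Paper

/-- Disjointness of bitmasks. -/
def disj (a b : Nat × Nat) : Bool := Nat.beq (Nat.land a.1 b.1) 0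

/-- The second mask meets the neighbourhood of the first. -/
def touch (a b : Nat × Nat) : Bool := !(Nat.beq (Nat.land a.2 b.1) 0)

/-- Search for a `K_{2,4}` minor among candidate branch sets. -/
def search (L : List (Nat × Nat)) : Bool :=
  L.any fun a => (L.filter (disj a)).any fun b =>
    (fun L2 : List (Nat × Nat) => L2.any fun c => (L2.filter (disj c)).any fun d =>
      ((L2.filter (disj c)).filter (disj d)).any fun e =>
        (((L2.filter (disj c)).filter (disj d)).filter (disj e)).any fun _ => true)
    ((L.filter (disj a)).filter fun c => disj b c && (touch a c && touch b c))

/-- Every mask is empty, or has a vertex isolated in it (and is not a singleton),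
or has more than `n - 5` elements, or is a candidate with a correct neighbourhood. -/
def check (n : Nat) (tbl : List Nat) (L : List (Nat × Nat)) : Bool :=
  (List.range (2 ^ n)).all fun m => Nat.beq m 0 ||
    ((List.range n).any fun i => Nat.testBit m i && (!(Nat.beq m (2 ^ i)) &&
        Nat.beq (Nat.land (tbl.getD i 0) m) 0)) ||
    Nat.ble (n + 1) (((List.range n).filter fun i => Nat.testBit m i).length + 5) ||
    (L.any fun p => Nat.beq p.1 m && (List.range n).all fun i =>
        !(Nat.testBit m i) || Nat.beq (Nat.land (tbl.getD i 0) p.2) (tbl.getD i 0))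

theorem land_ne_zero {a b i : Nat} (ha : a.testBit i = true) (hb : b.testBit i = true) :
    Nat.land a b ≠ 0 := by
  intro h
  have : (a &&& b).testBit i = true := by simp [Nat.testBit_and, ha, hb]
  change a &&& b = 0 at h
  simp [h] at this

theorem connected_cases {V : Type*} (G : SimpleGraph V) (s : Set V)
    (h : (G.induce s).Connected) (v : V) (hv : v ∈ s) :
    s = {v} ∨ ∃ w ∈ s, G.Adj v w := by
  by_cases hs : s = {v}
  · exact Or.inl hs
  right
  have : ∃ w ∈ s, w ≠ v := by
    by_contra hc
    push Not at hc
    exact hs (Set.eq_singleton_iff_unique_mem.2 ⟨hv, hc⟩)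
  obtain ⟨w, hw, hne⟩ := this
  have : Nontrivial s := ⟨⟨⟨v, hv⟩, ⟨w, hw⟩, fun h => hne (congrArg Subtype.val h).symm⟩⟩
  obtain ⟨u, hu⟩ := h.preconnected.exists_adj_of_nontrivial ⟨v, hv⟩
  exact ⟨u.1, u.2, hu⟩

theorem key (n : Nat) (G : SimpleGraph (Fin n)) (tbl : List Nat) (L : List (Nat × Nat))
    (hA : ∀ i j : Fin n, G.Adj i j → (tbl.getD i 0).testBit j = true)
    (hL : check n tbl L = true) (hs : search L = false) : MinorFree K24 G := by
  rintro ⟨B, hc, hd, he⟩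
  have step : ∀ w, ∃ p ∈ L, (∀ i : Fin n, p.1.testBit i = true ↔ i ∈ B w) ∧
      (∀ i, p.1.testBit i = true → i < n) ∧
      (∀ i j : Fin n, i ∈ B w → G.Adj i j → p.2.testBit j = true) := by
    intro w
    classical
    let m := Nat.ofBits (fun i : Fin n => decide (i ∈ B w))
    have hm : ∀ i : Fin n, m.testBit i = true ↔ i ∈ B w := by
      intro i
      simp [m, Nat.testBit_ofBits_lt]
    have hlt : m < 2 ^ n := Nat.ofBits_lt_two_pow _
    have hin : ∀ i, m.testBit i = true → i < n := by
      intro i hi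
      by_contra hni
      rw [Nat.testBit_lt_two_pow (hlt.trans_le (Nat.pow_le_pow_right (by norm_num)
        (not_lt.1 hni)))] at hi
      cases hi
    have h1 := List.all_eq_true.1 hL m (List.mem_range.2 hlt)
    simp only [Bool.or_eq_true, List.any_eq_true, List.all_eq_true, Bool.and_eq_true,
      List.mem_range, Nat.ble_eq, Bool.not_eq_true', Nat.beq_eq] at h1
    rcases h1 with ((h0 | ⟨i, hi, hmi, hne, hiso⟩) | hbig) | ⟨p, hp, rfl', hN⟩
    · obtain ⟨v⟩ := (hc w).nonempty
      have := (hm v.1).2 v.2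
      simp [h0] at this
    · exfalso
      rcases connected_cases G (B w) (hc w) ⟨i, hi⟩ ((hm ⟨i, hi⟩).1 hmi) with h | ⟨u, hu, huv⟩
      · have : m = 2 ^ i := by
          apply Nat.eq_of_testBit_eq
          intro j
          rw [Nat.testBit_two_pow]
          by_cases hij : i = j
          · subst hij; simpa using hmi
          · simp only [hij, decide_false]
            by_contra hj
            have hj : m.testBit j = true := by simpa using hj
            have := (hm ⟨j, hin j hj⟩).1 hj
            rw [h] at this
            simp at this
            exact hij this.symm
        rw [this] at hne
        simp at hne
      · exact land_ne_zero (hA _ _ huv) ((hm u).2 hu) hiso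
    · exfalso
      have hex : ∀ w', ∃ x, x ∈ B w' := fun w' =>
        ⟨(hc w').nonempty.some.1, (hc w').nonempty.some.2⟩
      choose r hr using hex
      let T : Finset ℕ := (Finset.range n).filter fun i => m.testBit i = true
      have hT : T.card = ((List.range n).filter fun i => Nat.testBit m i).length := by
        have : T = ((List.range n).filter fun i => Nat.testBit m i).toFinset := by
          ext i
          simp [T]
        rw [this, List.toFinset_card_of_nodup (List.nodup_range.filter _)]
      let R : Finset ℕ := (Finset.univ.erase w).image fun w' => (r w').val
      have hinj : Function.Injective fun w' => (r w').val := by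
        intro u v huv
        by_contra hne
        have h' : r u = r v := Fin.ext huv
        exact Set.disjoint_left.1 (hd u v hne) (hr u) (h' ▸ hr v)
      have hR : R.card = 5 := by
        rw [Finset.card_image_of_injective _ hinj, Finset.card_erase_of_mem (Finset.mem_univ _)]
        simp
      have hdisj : Disjoint T R := by
        rw [Finset.disjoint_left]
        intro i hiT hiR
        obtain ⟨u, hu, rfl⟩ := Finset.mem_image.1 hiR
        have h2 := (hm (r u)).1 (Finset.mem_filter.1 hiT).2
        exact Set.disjoint_left.1 (hd u w (Finset.ne_of_mem_erase hu)) (hr u) h2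
      have hsub : T ∪ R ⊆ Finset.range n := by
        apply Finset.union_subset (Finset.filter_subset _ _)
        intro i hiR
        obtain ⟨u, hu, rfl⟩ := Finset.mem_image.1 hiR
        exact Finset.mem_range.2 (r u).2
      have hcard := Finset.card_le_card hsub
      rw [Finset.card_union_of_disjoint hdisj, Finset.card_range] at hcard
      omega
    · refine ⟨p, hp, by rw [rfl']; exact hm, by rw [rfl']; exact hin, ?_⟩
      intro i j hi hij
      have h2 := hN i i.2
      have h3 := (hm i).2 hi
      rw [h3] at h2
      simp only [Bool.true_eq_false, false_or] at h2
      have h4 := hA i j hij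
      change (tbl.getD i 0) &&& p.2 = _ at h2
      rw [← h2] at h4
      simp only [Nat.testBit_and, Bool.and_eq_true] at h4
      exact h4.2
  choose p hpL hpB hpn hpN using step
  have hdis : ∀ u v, u ≠ v → disj (p u) (p v) = true := by
    intro u v huv
    simp only [disj, Nat.beq_eq]
    apply Nat.eq_of_testBit_eq
    intro i
    change ((p u).1 &&& (p v).1).testBit i = _
    rw [Nat.testBit_and, Nat.zero_testBit]
    by_contra hcon
    simp only [Bool.not_eq_false, Bool.and_eq_true] at hcon
    have hi := hpn u i hcon.1
    exact Set.disjoint_left.1 (hd u v huv) ((hpB u ⟨i, hi⟩).1 hcon.1)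
      ((hpB v ⟨i, hi⟩).1 hcon.2)
  have htouch : ∀ u v, K24.Adj u v → touch (p u) (p v) = true := by
    intro u v huv
    obtain ⟨x, hx, y, hy, hxy⟩ := he u v huv
    have := land_ne_zero (hpN u x y hx hxy) ((hpB v y).2 hy)
    simp only [touch, Bool.not_eq_true', ← Bool.not_eq_true, Nat.beq_eq]
    exact this
  have ht : ∀ (i : Fin 2) (j : Fin 4), touch (p (.inl i)) (p (.inr j)) = true :=
    fun i j => htouch _ _ (by simp [K24])
  have : search L = true := by
    simp only [search, List.any_eq_true, List.mem_filter, Bool.and_eq_true]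
    refine ⟨p (.inl 0), hpL _, p (.inl 1), ⟨hpL _, hdis _ _ (by simp)⟩,
      p (.inr 0), ?_, p (.inr 1), ?_, p (.inr 2), ?_, p (.inr 3), ?_, trivial⟩ <;>
    simp [hpL, ht, hdis]
  rw [hs] at this
  cases this

/-- Adjacency rows of the graph `A`. -/
def tblA : List Nat := [56, 60, 58, 7, 39, 23]

/-- Candidate branch sets with their neighbourhoods in `A`. -/
def candA : List (Nat × Nat) :=
  [(1, 56), (2, 60), (4, 58), (8, 7), (16, 39), (32, 23)]

/-- Adjacency rows of the graph `B`. -/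
def tblB : List Nat := [120, 112, 104, 21, 11, 71, 39]

/-- Candidate branch sets with their neighbourhoods in `B`. -/
def candB : List (Nat × Nat) :=
  [(1, 120), (2, 112), (4, 104), (8, 21), (9, 125), (12, 125), (16, 11), (17, 123), (18, 123),
    (24, 31), (32, 71), (33, 127), (34, 119), (36, 111), (64, 39), (65, 127), (66, 119), (68,
    111), (96, 103)]

/-- Adjacency rows of the graph `C`. -/
def tblC : List Nat := [70, 133, 35, 224, 224, 28, 25, 26]

/-- Candidate branch sets with their neighbourhoods in `C`. -/
def candC : List (Nat × Nat) :=
  [(1, 70), (2, 133), (3, 199), (4, 35), (5, 103), (6, 167), (7, 231), (8, 224), (16, 224), (32,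
    28), (36, 63), (37, 127), (38, 191), (40, 252), (44, 255), (48, 252), (52, 255), (56, 252),
    (64, 25), (65, 95), (67, 223), (69, 127), (72, 249), (73, 255), (80, 249), (81, 255), (88,
    249), (104, 253), (112, 253), (128, 26), (130, 159), (131, 223), (134, 191), (136, 250),
    (138, 255), (144, 250), (146, 255), (152, 250), (168, 254), (176, 254), (200, 251), (208,
    251)]

theorem checkA : check 6 tblA candA = true := by decide +kernel
theorem checkB : check 7 tblB candB = true := by decide +kernel
theorem checkC : check 8 tblC candC = true := by decide +kernel
theorem searchA : search candA = false := by decide +kernel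
theorem searchB : search candB = false := by decide +kernel
theorem searchC : search candC = false := by decide +kernel

/-- Corollary 12: the graphs `C`, `B⁺`, `B`, `A⁺`, `A`, and
`K_{3,3}` are `K_{2,4}`-minor-free. -/
theorem small_graphs_K24MinorFree :
    MinorFree K24 GC ∧ MinorFree K24 GBplus ∧ MinorFree K24 GB ∧
    MinorFree K24 GAplus ∧ MinorFree K24 GA ∧ MinorFree K24 K33 := by
  refine ⟨key 8 _ tblC candC ?_ checkC searchC, key 7 _ tblB candB ?_ checkB searchB,
    key 7 _ tblB candB ?_ checkB searchB, key 6 _ tblA candA ?_ checkA searchA,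
    key 6 _ tblA candA ?_ checkA searchA, key 6 _ tblA candA ?_ checkA searchA⟩
  · simp only [GC, GCplus, SimpleGraph.deleteEdges_adj, SimpleGraph.fromRel_adj,
      Set.mem_singleton_iff]
    decide +kernel
  · simp only [GBplus, GB, AddEdge, SimpleGraph.sup_adj, SimpleGraph.fromRel_adj]
    decide +kernel
  · simp only [GB, SimpleGraph.fromRel_adj]
    decide +kernel
  · simp only [GAplus, GA, K33, AddEdge, SimpleGraph.sup_adj, SimpleGraph.fromRel_adj]
    decide +kernel
  · simp only [GA, K33, AddEdge, SimpleGraph.sup_adj, SimpleGraph.fromRel_adj]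
    decide +kernel
  · simp only [K33, SimpleGraph.fromRel_adj]
    decide +kernel

end K24Paper
end
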